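/- Let V ∈ ℝ^{C×D} have no zero entries and pairwise distinct entries in its d-th column, let a ∈ ℝ^C, and let x' ∈ ℝ^D with x'_d ≠ 0. Then there exist a class c* and β > 0 such that for every α > β the maximum softmax probability is attained at c*, i.e. softmax(V x_α + a)_{c*} = max_{c} softmax(V x_α + a)_c, and moreover the Euclidean norm of the gradient of x ↦ softmax(Vx + a)_{c*} evaluated at x_α tends to 0 as α → ∞. -/

import Mathlib

/-- The softmax function on `ℝ^C`. -/
noncomputable def softmax {C : ℕ} (z : Fin C → ℝ) : Fin C → ℝ :=
  fun c => Real.exp (z c) / ∑ c', Real.exp (z c')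

/-- The point `x'` scaled by `α` in coordinate `d` (all other coordinates unchanged). -/
def scaled {D : ℕ} (x' : Fin D → ℝ) (d : Fin D) (α : ℝ) : Fin D → ℝ :=
  Function.update x' d (α * x' d)

theorem softmax_eq_inv_sum {C : ℕ} (z : Fin C → ℝ) (k : Fin C) :
    softmax z k = (∑ c, Real.exp (z c - z k))⁻¹ := by
  simp only [softmax, Real.exp_sub, ← Finset.sum_div, inv_div]

theorem softmax_le_softmax {C : ℕ} {z : Fin C → ℝ} {c k : Fin C} (h : z c ≤ z k) :
    softmax z c ≤ softmax z k :=
  div_le_div_of_nonneg_right (Real.exp_le_exp.2 h)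
    (Finset.sum_nonneg fun _ _ => (Real.exp_pos _).le)

theorem hasFDerivAt_softmax {E : Type*} [NormedAddCommGroup E] [NormedSpace ℝ E] {C : ℕ}
    {z : E → Fin C → ℝ} {L : Fin C → E →L[ℝ] ℝ} {x : E}
    (hz : ∀ c, HasFDerivAt (fun y => z y c) (L c) x) (k : Fin C) :
    HasFDerivAt (fun y => softmax (z y) k)
      (-((∑ c, Real.exp (z x c - z x k)) ^ 2)⁻¹ •
        ∑ c, Real.exp (z x c - z x k) • (L c - L k)) x := by
  have hS : (∑ c, Real.exp (z x c - z x k)) ≠ 0 :=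
    (Finset.sum_pos (fun _ _ => Real.exp_pos _) ⟨k, Finset.mem_univ k⟩).ne'
  have h := HasFDerivAt.fun_sum (u := Finset.univ) fun c _ => ((hz c).sub (hz k)).exp
  simp only [softmax_eq_inv_sum]
  exact (hasDerivAt_inv hS).comp_hasFDerivAt x h

theorem mulVec_scaled {C D : ℕ} (V : Matrix (Fin C) (Fin D) ℝ) (x' : Fin D → ℝ) (d : Fin D)
    (α : ℝ) (c : Fin C) :
    V.mulVec (scaled x' d α) c = V.mulVec x' c + (α - 1) * (V c d * x' d) := by
  have h : scaled x' d α = x' + Pi.single d ((α - 1) * x' d) := by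
    ext i
    rcases eq_or_ne i d with rfl | hi
    · simp [scaled]
      ring
    · simp [scaled, hi]
  rw [h, Matrix.mulVec_add, Pi.add_apply, Matrix.mulVec_single]
  simp
  ring

theorem tendsto_logit_sub_atBot {C D : ℕ} (V : Matrix (Fin C) (Fin D) ℝ) (a : Fin C → ℝ)
    (x' : Fin D → ℝ) (d : Fin D) {c k : Fin C} (h : V c d * x' d < V k d * x' d) :
    Filter.Tendsto
      (fun α : ℝ => (V.mulVec (scaled x' d α) + a) c - (V.mulVec (scaled x' d α) + a) k)
      Filter.atTop Filter.atBot := by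
  have h1 : Filter.Tendsto (fun α : ℝ => (V c d * x' d - V k d * x' d) * α)
      Filter.atTop Filter.atBot :=
    Filter.tendsto_id.const_mul_atTop_of_neg (sub_neg.2 h)
  refine (Filter.tendsto_atBot_add_const_right _
    (V.mulVec x' c - V.mulVec x' k + a c - a k - (V c d * x' d - V k d * x' d)) h1).congr ?_
  intro α
  simp only [Pi.add_apply, mulVec_scaled]
  ring

theorem hasFDerivAt_mulVec_add {C D : ℕ} (V : Matrix (Fin C) (Fin D) ℝ) (a : Fin C → ℝ)
    (c : Fin C) (x : EuclideanSpace ℝ (Fin D)) :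
    HasFDerivAt
      (fun y : EuclideanSpace ℝ (Fin D) => (V.mulVec (WithLp.equiv 2 (Fin D → ℝ) y) + a) c)
      (∑ i, V c i • (EuclideanSpace.proj i : EuclideanSpace ℝ (Fin D) →L[ℝ] ℝ)) x := by
  refine (HasFDerivAt.add_const (a c) (ContinuousLinearMap.hasFDerivAt _)).congr_of_eventuallyEq
    (Filter.Eventually.of_forall fun y => ?_)
  simp [Matrix.mulVec, dotProduct]

theorem norm_gradient {E : Type*} [NormedAddCommGroup E] [InnerProductSpace ℝ E]
    [CompleteSpace E] (f : E → ℝ) (x : E) : ‖gradient f x‖ = ‖fderiv ℝ f x‖ :=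
  LinearIsometryEquiv.norm_map _ _

theorem stmt_4 (D C : ℕ) (hC : 1 ≤ C)
    (V : Matrix (Fin C) (Fin D) ℝ) (a : Fin C → ℝ) (d : Fin D)
    (hV : ∀ c d', V c d' ≠ 0)
    (hcol : Function.Injective fun c => V c d)
    (x' : Fin D → ℝ) (hx' : x' d ≠ 0) :
    ∃ cstar : Fin C, ∃ β > (0 : ℝ),
      (∀ α > β, ∀ c : Fin C,
        softmax (V.mulVec (scaled x' d α) + a) c ≤
          softmax (V.mulVec (scaled x' d α) + a) cstar) ∧
      Filter.Tendsto
        (fun α : ℝ =>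
          ‖gradient
              (fun x : EuclideanSpace ℝ (Fin D) =>
                softmax (V.mulVec (WithLp.equiv 2 (Fin D → ℝ) x) + a) cstar)
              ((WithLp.equiv 2 (Fin D → ℝ)).symm (scaled x' d α))‖)
        Filter.atTop (nhds 0) := by
  have : Nonempty (Fin C) := ⟨⟨0, hC⟩⟩
  obtain ⟨k, hk⟩ := Finite.exists_max fun c => V c d * x' d
  have hlt : ∀ c, c ≠ k → V c d * x' d < V k d * x' d := fun c hc =>
    lt_of_le_of_ne (hk c) fun h => hc (hcol (mul_right_cancel₀ hx' h))
  have hlim : ∀ c, c ≠ k → Filter.Tendsto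
      (fun α : ℝ => (V.mulVec (scaled x' d α) + a) c - (V.mulVec (scaled x' d α) + a) k)
      Filter.atTop Filter.atBot := fun c hc => tendsto_logit_sub_atBot V a x' d (hlt c hc)
  have hev : ∀ᶠ α : ℝ in Filter.atTop, ∀ c,
      (V.mulVec (scaled x' d α) + a) c ≤ (V.mulVec (scaled x' d α) + a) k := by
    refine Filter.eventually_all.2 fun c => ?_
    rcases eq_or_ne c k with rfl | hc
    · exact Filter.Eventually.of_forall fun _ => le_rfl
    · filter_upwards [(hlim c hc).eventually_le_atBot 0] with α hα using sub_nonpos.1 hα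
  obtain ⟨β, hβ⟩ := Filter.eventually_atTop.1 hev
  refine ⟨k, max β 1, by positivity, fun α hα c =>
    softmax_le_softmax (hβ α ((le_max_left _ _).trans hα.le) c), ?_⟩
  have hexp : ∀ c, Filter.Tendsto (fun α : ℝ => Real.exp
      ((V.mulVec (scaled x' d α) + a) c - (V.mulVec (scaled x' d α) + a) k))
      Filter.atTop (nhds (if c = k then 1 else 0)) := by
    intro c
    rcases eq_or_ne c k with rfl | hc
    · simp
    · rw [if_neg hc]
      exact Real.tendsto_exp_atBot.comp (hlim c hc)
  simp only [norm_gradient,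
    (hasFDerivAt_softmax (fun c => hasFDerivAt_mulVec_add V a c _) k).fderiv,
    Equiv.apply_symm_apply]
  have hsum := tendsto_finsetSum Finset.univ fun c _ => hexp c
  have hnum := tendsto_finsetSum Finset.univ fun c _ => (hexp c).smul_const
    ((∑ i, V c i • (EuclideanSpace.proj i : EuclideanSpace ℝ (Fin D) →L[ℝ] ℝ)) -
      ∑ i, V k i • (EuclideanSpace.proj i : EuclideanSpace ℝ (Fin D) →L[ℝ] ℝ))
  have h := (((hsum.pow 2).inv₀ (by simp)).neg.smul hnum).norm
  convert h using 2
  simp
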